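/- arXiv:hep-th/0501228 — 3 statements merged into one kernel-verified Lean document; each statement's English description precedes it below -/
import Mathlib

section
/- For every integer d ≥ 1 and every integer n ≥ 1, the ℝ-algebra homomorphism from the tensor product MvPolynomial (Fin d) ℝ ⊗[ℝ] MvPolynomial (Fin (n−1) × Fin d) ℝ to MvPolynomial (Fin n × Fin d) ℝ determined by sending X_μ ⊗ 1 to the center-of-mass variable P_μ and 1 ⊗ X_{k,μ} to the consecutive difference variable Y_{k,μ} is bijective. -/
open MvPolynomial

section ComRelative

open scoped TensorProduct

theorem partialSum_castSucc_sub_succ {V : Type*} [AddCommGroup V] {m : ℕ}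
    (x : Fin (m + 1) → V) (i : Fin (m + 1)) :
    Fin.partialSum (fun k : Fin m => x k.castSucc - x k.succ) i = x 0 - x i := by
  induction i using Fin.induction with
  | zero => simp
  | succ k ih => rw [Fin.partialSum_succ, ih]; abel

variable {V W : Type*} [AddCommGroup V] [Module ℝ V] [AddCommGroup W] [Module ℝ W] {m : ℕ}

/-- The configuration of `m + 1` vectors with sum `p` and consecutive differences `y`. -/
noncomputable def ofComRelative (p : V) (y : Fin m → V) (i : Fin (m + 1)) : V :=
  ((m : ℝ) + 1)⁻¹ • (p + ∑ j, Fin.partialSum y j) - Fin.partialSum y i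

theorem sum_ofComRelative (p : V) (y : Fin m → V) : ∑ i, ofComRelative p y i = p := by
  have h : (m : ℝ) + 1 ≠ 0 := by positivity
  simp only [ofComRelative, Finset.sum_sub_distrib, Finset.sum_const, Finset.card_univ,
    Fintype.card_fin, ← Nat.cast_smul_eq_nsmul ℝ, smul_smul, Nat.cast_add, Nat.cast_one,
    mul_inv_cancel₀ h, one_smul, add_sub_cancel_right]

theorem ofComRelative_castSucc_sub_succ (p : V) (y : Fin m → V) (k : Fin m) :
    ofComRelative p y k.castSucc - ofComRelative p y k.succ = y k := by
  simp only [ofComRelative, Fin.partialSum_succ]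
  abel

theorem ofComRelative_sum_sub (x : Fin (m + 1) → V) (i : Fin (m + 1)) :
    ofComRelative (∑ j, x j) (fun k : Fin m => x k.castSucc - x k.succ) i = x i := by
  have h : (m : ℝ) + 1 ≠ 0 := by positivity
  simp only [ofComRelative, partialSum_castSucc_sub_succ, Finset.sum_sub_distrib,
    Finset.sum_const, Finset.card_univ, Fintype.card_fin, add_sub_cancel,
    ← Nat.cast_smul_eq_nsmul ℝ, smul_smul, Nat.cast_add, Nat.cast_one, inv_mul_cancel₀ h,
    one_smul, sub_sub_cancel]

theorem map_partialSum (f : V →ₗ[ℝ] W) (y : Fin m → V) (i : Fin (m + 1)) :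
    f (Fin.partialSum y i) = Fin.partialSum (fun k => f (y k)) i := by
  induction i using Fin.induction with
  | zero => simp
  | succ k ih => simp [Fin.partialSum_succ, ih]

theorem map_ofComRelative (f : V →ₗ[ℝ] W) (p : V) (y : Fin m → V) (i : Fin (m + 1)) :
    f (ofComRelative p y i) = ofComRelative (f p) (fun k => f (y k)) i := by
  simp [ofComRelative, map_partialSum]

/-- The algebra homomorphism sending the center-of-mass variables and the consecutive difference
variables of `m + 1` momenta to the corresponding polynomials. -/
noncomputable def comRelativeHom (σ : Type*) (m : ℕ) :
    MvPolynomial σ ℝ ⊗[ℝ] MvPolynomial (Fin m × σ) ℝ →ₐ[ℝ] MvPolynomial (Fin (m + 1) × σ) ℝ :=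
  Algebra.TensorProduct.productMap
    (aeval fun μ => ∑ i : Fin (m + 1), X (i, μ))
    (aeval fun kμ : Fin m × σ => X (kμ.1.castSucc, kμ.2) - X (kμ.1.succ, kμ.2))

/-- The inverse of `comRelativeHom`. -/
noncomputable def comRelativeInv (σ : Type*) (m : ℕ) :
    MvPolynomial (Fin (m + 1) × σ) ℝ →ₐ[ℝ] MvPolynomial σ ℝ ⊗[ℝ] MvPolynomial (Fin m × σ) ℝ :=
  aeval fun iμ => ofComRelative (X iμ.2 ⊗ₜ 1) (fun k : Fin m => 1 ⊗ₜ X (k, iμ.2)) iμ.1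

theorem comRelativeHom_comp_inv (σ : Type*) (m : ℕ) :
    (comRelativeHom σ m).comp (comRelativeInv σ m) = AlgHom.id ℝ _ := by
  refine MvPolynomial.algHom_ext fun ⟨i, μ⟩ => ?_
  have h := map_ofComRelative (comRelativeHom σ m).toLinearMap
    (X μ ⊗ₜ 1) (fun k : Fin m => 1 ⊗ₜ X (k, μ)) i
  simp only [AlgHom.toLinearMap_apply] at h
  simp only [AlgHom.comp_apply, comRelativeInv, aeval_X, h, AlgHom.id_apply]
  simpa [comRelativeHom] using
    ofComRelative_sum_sub (fun j => (X (j, μ) : MvPolynomial (Fin (m + 1) × σ) ℝ)) i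

theorem comRelativeInv_comp_hom (σ : Type*) (m : ℕ) :
    (comRelativeInv σ m).comp (comRelativeHom σ m) = AlgHom.id ℝ _ := by
  ext μ
  · simp [comRelativeHom, comRelativeInv, sum_ofComRelative]
  · simp [comRelativeHom, comRelativeInv, ofComRelative_castSucc_sub_succ]

theorem comRelativeHom_bijective (σ : Type*) (m : ℕ) :
    Function.Bijective (comRelativeHom σ m) :=
  (AlgEquiv.ofAlgHom _ _ (comRelativeHom_comp_inv σ m) (comRelativeInv_comp_hom σ m)).bijective

end ComRelative

/-- The ℝ-algebra homomorphism
`MvPolynomial (Fin d) ℝ ⊗[ℝ] MvPolynomial (Fin (n−1) × Fin d) ℝ → MvPolynomial (Fin n × Fin d) ℝ`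
sending `X_μ ⊗ 1` to the center-of-mass variable `P_μ = ∑ i, X_{i,μ}` and `1 ⊗ X_{k,μ}` to the
consecutive difference variable `Y_{k,μ} = X_{k,μ} − X_{k+1,μ}` is bijective. -/
theorem com_relative_tensor_product_bijective (d n : ℕ) (hd : 1 ≤ d) (hn : 1 ≤ n) :
    Function.Bijective
      (Algebra.TensorProduct.productMap
        ((aeval (fun μ : Fin d =>
          (∑ i : Fin n, X (i, μ) : MvPolynomial (Fin n × Fin d) ℝ))) :
          MvPolynomial (Fin d) ℝ →ₐ[ℝ] MvPolynomial (Fin n × Fin d) ℝ)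
        ((aeval (fun kμ : Fin (n - 1) × Fin d =>
          (X (⟨kμ.1.val, by have := kμ.1.isLt; omega⟩, kμ.2)
            - X (⟨kμ.1.val + 1, by have := kμ.1.isLt; omega⟩, kμ.2) :
            MvPolynomial (Fin n × Fin d) ℝ))) :
          MvPolynomial (Fin (n - 1) × Fin d) ℝ →ₐ[ℝ] MvPolynomial (Fin n × Fin d) ℝ)) := by
  obtain ⟨m, rfl⟩ := Nat.exists_eq_add_of_le' hn
  exact comRelativeHom_bijective (Fin d) m
end

section
/- Fix integers d ≥ 1 and n ≥ 1, and let the symmetric group on Fin n act on R = MvPolynomial (Fin n × Fin d) ℝ by ℝ-algebra automorphisms sending X_{i,μ} to X_{σ(i),μ}. If P ∈ R is invariant under this action, then P lies in the ℝ-submodule of R spanned by the products a · b where a belongs to the ℝ-subalgebra generated by the center-of-mass variables P_μ = Σ_{i=1}^{n} X_{i,μ} (μ ∈ Fin d) and b is an element of the ℝ-subalgebra generated by the differences X_{i,μ} − X_{j,μ} (i, j ∈ Fin n, μ ∈ Fin d) which is itself invariant under the symmetric group action. -/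
open MvPolynomial

/-- The center-of-mass variables and the differences together generate the whole ring. -/
theorem adjoin_sum_sup_adjoin_sub_eq_top (d n : ℕ) (hn : 1 ≤ n) :
    Algebra.adjoin ℝ
        (Set.range fun μ : Fin d =>
          (∑ i : Fin n, X (i, μ) : MvPolynomial (Fin n × Fin d) ℝ)) ⊔
      Algebra.adjoin ℝ
        (Set.range fun t : Fin n × Fin n × Fin d =>
          (X (t.1, t.2.2) - X (t.2.1, t.2.2) : MvPolynomial (Fin n × Fin d) ℝ)) = ⊤ := by
  rw [← Algebra.adjoin_union, eq_top_iff, ← MvPolynomial.adjoin_range_X, Algebra.adjoin_le_iff]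
  rintro _ ⟨⟨i, μ⟩, rfl⟩
  have hn' : (n : ℝ) ≠ 0 := by positivity
  have key : (X (i, μ) : MvPolynomial (Fin n × Fin d) ℝ) =
      (n : ℝ)⁻¹ • ((∑ j : Fin n, X (j, μ)) + ∑ j : Fin n, (X (i, μ) - X (j, μ))) := by
    rw [eq_inv_smul_iff₀ hn', ← Finset.sum_add_distrib]
    simp [← Nat.cast_smul_eq_nsmul ℝ]
  rw [SetLike.mem_coe, key]
  refine Subalgebra.smul_mem _ (Subalgebra.add_mem _ ?_ (Subalgebra.sum_mem _ fun j _ => ?_)) _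
  · exact Algebra.subset_adjoin (Or.inl ⟨μ, rfl⟩)
  · exact Algebra.subset_adjoin (Or.inr ⟨(i, j, μ), rfl⟩)

/-- Permutations of the particles fix the subalgebra of center-of-mass variables pointwise. -/
theorem rename_perm_eq_self_of_mem_adjoin_sum {d n : ℕ} (σ : Equiv.Perm (Fin n))
    {a : MvPolynomial (Fin n × Fin d) ℝ}
    (ha : a ∈ Algebra.adjoin ℝ
      (Set.range fun μ : Fin d =>
        (∑ i : Fin n, X (i, μ) : MvPolynomial (Fin n × Fin d) ℝ))) :
    rename (fun p : Fin n × Fin d => (σ p.1, p.2)) a = a := by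
  change _ ∈ AlgHom.equalizer (rename fun p : Fin n × Fin d => (σ p.1, p.2)) (AlgHom.id ℝ _)
  refine Algebra.adjoin_le ?_ ha
  rintro _ ⟨μ, rfl⟩
  simpa using Equiv.sum_comp σ fun i => (X (i, μ) : MvPolynomial (Fin n × Fin d) ℝ)

/-- The subalgebra of differences is stable under permutations of the particles. -/
theorem rename_perm_mem_adjoin_sub {d n : ℕ} (σ : Equiv.Perm (Fin n))
    {b : MvPolynomial (Fin n × Fin d) ℝ}
    (hb : b ∈ Algebra.adjoin ℝ
      (Set.range fun t : Fin n × Fin n × Fin d =>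
        (X (t.1, t.2.2) - X (t.2.1, t.2.2) : MvPolynomial (Fin n × Fin d) ℝ))) :
    rename (fun p : Fin n × Fin d => (σ p.1, p.2)) b ∈ Algebra.adjoin ℝ
      (Set.range fun t : Fin n × Fin n × Fin d =>
        (X (t.1, t.2.2) - X (t.2.1, t.2.2) : MvPolynomial (Fin n × Fin d) ℝ)) := by
  rw [← Subalgebra.mem_comap]
  refine Algebra.adjoin_le ?_ hb
  rintro _ ⟨⟨i, j, μ⟩, rfl⟩
  exact Algebra.subset_adjoin ⟨(σ i, σ j, μ), by simp⟩

/-- The sum of a polynomial over all permutations of the particles is invariant. -/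
theorem rename_perm_sum_rename_perm {d n : ℕ} (τ : Equiv.Perm (Fin n))
    (Q : MvPolynomial (Fin n × Fin d) ℝ) :
    rename (fun p : Fin n × Fin d => (τ p.1, p.2))
        (∑ σ : Equiv.Perm (Fin n), rename (fun p : Fin n × Fin d => (σ p.1, p.2)) Q) =
      ∑ σ : Equiv.Perm (Fin n), rename (fun p : Fin n × Fin d => (σ p.1, p.2)) Q := by
  rw [map_sum]
  refine Eq.trans (Finset.sum_congr rfl fun σ _ => ?_) (Equiv.sum_comp (Equiv.mulLeft τ)
    fun σ => rename (fun p : Fin n × Fin d => (σ p.1, p.2)) Q)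
  rw [rename_rename]
  rfl

/-- Every polynomial in the `n·d` variables `X_{i,μ}` which is invariant under the
symmetric group permuting the first index lies in the ℝ-linear span of products `a·b`,
where `a` belongs to the subalgebra generated by the center-of-mass variables
`P_μ = ∑ i, X_{i,μ}` and `b` is a symmetric-group-invariant element of the subalgebra
generated by the differences `X_{i,μ} − X_{j,μ}`. -/
theorem symmetric_polynomial_decomposition_com_relative (d n : ℕ) (hd : 1 ≤ d) (hn : 1 ≤ n)
    (P : MvPolynomial (Fin n × Fin d) ℝ)
    (hP : ∀ σ : Equiv.Perm (Fin n),
      rename (fun p : Fin n × Fin d => (σ p.1, p.2)) P = P) :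
    P ∈ Submodule.span ℝ
      {x : MvPolynomial (Fin n × Fin d) ℝ |
        ∃ a ∈ Algebra.adjoin ℝ
            (Set.range fun μ : Fin d =>
              (∑ i : Fin n, X (i, μ) : MvPolynomial (Fin n × Fin d) ℝ)),
          ∃ b ∈ Algebra.adjoin ℝ
              (Set.range fun t : Fin n × Fin n × Fin d =>
                (X (t.1, t.2.2) - X (t.2.1, t.2.2) : MvPolynomial (Fin n × Fin d) ℝ)),
            (∀ σ : Equiv.Perm (Fin n),
              rename (fun p : Fin n × Fin d => (σ p.1, p.2)) b = b) ∧ x = a * b} := by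
  have avg : (Fintype.card (Equiv.Perm (Fin n)) : ℝ) • P =
      ∑ σ : Equiv.Perm (Fin n), rename (fun p : Fin n × Fin d => (σ p.1, p.2)) P := by
    simp only [hP, Finset.sum_const, Finset.card_univ, Nat.cast_smul_eq_nsmul]
  refine (Submodule.smul_mem_iff _ (Nat.cast_ne_zero (R := ℝ).mpr
    (Fintype.card_ne_zero (α := Equiv.Perm (Fin n))))).mp ?_
  rw [avg]
  clear avg hP
  have hP : P ∈ Subalgebra.toSubmodule (⊤ : Subalgebra ℝ (MvPolynomial (Fin n × Fin d) ℝ)) :=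
    trivial
  rw [← adjoin_sum_sup_adjoin_sub_eq_top d n hn, ← Subalgebra.mul_toSubmodule] at hP
  induction hP using Submodule.mul_induction_on' with
  | mem_mul_mem a ha b hb =>
    refine Submodule.subset_span ⟨a, ha, _, Subalgebra.sum_mem _ fun σ _ =>
      rename_perm_mem_adjoin_sub σ hb, fun τ => rename_perm_sum_rename_perm τ b, ?_⟩
    rw [Finset.mul_sum]
    refine Finset.sum_congr rfl fun σ _ => ?_
    rw [map_mul, rename_perm_eq_self_of_mem_adjoin_sum σ ha]
  | add x _ y _ hx hy =>
    simpa only [map_add, Finset.sum_add_distrib] using Submodule.add_mem _ hx hy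
end

section
/- Fix integers d ≥ 1 and n ≥ 1, and work in R = MvPolynomial (Fin n × Fin d) ℝ. For q ∈ ℝ^d let τ_q be the ℝ-algebra endomorphism of R determined by sending X_{i,μ} to X_{i,μ} + C(q_μ) (the variable shifted by the constant q_μ) for all i ∈ Fin n, μ ∈ Fin d. Then a polynomial P ∈ R satisfies τ_q(P) = P for every q ∈ ℝ^d if and only if P belongs to the ℝ-subalgebra of R generated by the differences X_{i,μ} − X_{j,μ} (i, j ∈ Fin n, μ ∈ Fin d). -/
open MvPolynomial

/-- A polynomial invariant under simultaneous translations is unchanged when every variable is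
replaced by its difference with a fixed reference vector. -/
theorem eq_aeval_sub_of_translation_invariant {K ι κ : Type*} [CommRing K] [IsDomain K]
    [Infinite K] (i₀ : ι) {P : MvPolynomial (ι × κ) K}
    (h : ∀ q : κ → K,
      aeval (fun p : ι × κ => (X p + C (q p.2) : MvPolynomial (ι × κ) K)) P = P) :
    aeval (fun p : ι × κ => (X p - X (i₀, p.2) : MvPolynomial (ι × κ) K)) P = P := by
  refine MvPolynomial.funext fun x => ?_
  conv_rhs => rw [← h fun μ => -x (i₀, μ)]
  simp only [← coe_aeval_eq_eval, RingHom.coe_coe]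
  rw [comp_aeval_apply, comp_aeval_apply]
  congr 2
  funext p
  simp [sub_eq_add_neg]

/-- A polynomial `P` in the variables `X_{i,μ}` (`i ∈ Fin n`, `μ ∈ Fin d`) is invariant
under every simultaneous translation `X_{i,μ} ↦ X_{i,μ} + q_μ` of all `n` momentum vectors
by a common vector `q ∈ ℝ^d` if and only if `P` belongs to the ℝ-subalgebra generated by
the differences `X_{i,μ} − X_{j,μ}`. -/
theorem translation_invariant_iff_mem_adjoin_differences (d n : ℕ) (hd : 1 ≤ d) (hn : 1 ≤ n)
    (P : MvPolynomial (Fin n × Fin d) ℝ) :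
    (∀ q : Fin d → ℝ,
      aeval (fun p : Fin n × Fin d =>
        (X p + C (q p.2) : MvPolynomial (Fin n × Fin d) ℝ)) P = P) ↔
    P ∈ Algebra.adjoin ℝ
      (Set.range fun t : Fin n × Fin n × Fin d =>
        (X (t.1, t.2.2) - X (t.2.1, t.2.2) : MvPolynomial (Fin n × Fin d) ℝ)) := by
  constructor
  · intro h
    rw [← eq_aeval_sub_of_translation_invariant ⟨0, hn⟩ h, Algebra.adjoin_range_eq_range_aeval]
    refine ⟨aeval (fun p => X (p.1, ⟨0, hn⟩, p.2)) P, ?_⟩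
    simp [bind₁_bind₁]
  · intro h q
    refine AlgHom.adjoin_le_equalizer _ (AlgHom.id ℝ _) ?_ h
    rintro _ ⟨t, rfl⟩
    simp
end
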